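/- Let 0 < r_p < ∞, P_a > 0 and P_d ∈ ℝ, and suppose the set Ω of probability measures μ supported in [0, r_p] satisfying ∫ r² dμ(r) ≤ P_a and ∫ g(r) dμ(r) ≥ P_d is nonempty. Then H attains its maximum over Ω at a unique measure μ°, and the support of μ° is a finite set. -/

import Mathlib

open MeasureTheory Real Set

/-- Modified Bessel function of the first kind of order zero. -/
noncomputable def I0 (x : ℝ) : ℝ :=
  (1 / π) * ∫ θ in (0:ℝ)..π, Real.exp (x * Real.cos θ)

/-- The kernel `K(R,r) = R e^{-(R²+r²)/2} I₀(rR)`. -/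
noncomputable def Ker (R r : ℝ) : ℝ :=
  R * Real.exp (-(R ^ 2 + r ^ 2) / 2) * I0 (r * R)

/-- Output density induced by an input (amplitude) distribution `μ`. -/
noncomputable def fout (μ : Measure ℝ) (R : ℝ) : ℝ := ∫ r, Ker R r ∂μ

/-- Output entropy `H(μ) = -∫₀^∞ f_μ(R) ln (f_μ(R)/R) dR`. -/
noncomputable def Hout (μ : Measure ℝ) : ℝ :=
  -∫ R in Ioi (0:ℝ), fout μ R * Real.log (fout μ R / R)

open Filter Topology
open scoped ENNReal

/-! ### The Bessel function `I0` -/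

lemma continuous_I0 : Continuous I0 := by
  unfold I0
  refine continuous_const.mul ?_
  exact intervalIntegral.continuous_parametric_intervalIntegral_of_continuous'
    (by fun_prop) 0 π

lemma one_le_I0 (x : ℝ) : 1 ≤ I0 x := by
  have h : ∫ θ in (0:ℝ)..π, (1 + x * Real.cos θ) ≤ ∫ θ in (0:ℝ)..π, Real.exp (x * Real.cos θ) := by
    refine intervalIntegral.integral_mono_on pi_pos.le ?_ ?_ ?_
    · exact Continuous.intervalIntegrable (by fun_prop) _ _
    · exact Continuous.intervalIntegrable (by fun_prop) _ _
    · intro θ _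
      linarith [Real.add_one_le_exp (x * Real.cos θ)]
  have h' : ∫ θ in (0:ℝ)..π, (1 + x * Real.cos θ) = π := by
    rw [intervalIntegral.integral_add (by simp)
      (Continuous.intervalIntegrable (by fun_prop) _ _)]
    simp
  rw [h'] at h
  unfold I0
  rw [one_div_mul_eq_div, le_div_iff₀ pi_pos]
  linarith

lemma I0_pos (x : ℝ) : 0 < I0 x := zero_lt_one.trans_le (one_le_I0 x)

lemma I0_le_exp_abs (x : ℝ) : I0 x ≤ Real.exp |x| := by
  have h : ∫ θ in (0:ℝ)..π, Real.exp (x * Real.cos θ) ≤ ∫ _θ in (0:ℝ)..π, Real.exp |x| := by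
    refine intervalIntegral.integral_mono_on pi_pos.le ?_ ?_ ?_
    · exact Continuous.intervalIntegrable (by fun_prop) _ _
    · exact Continuous.intervalIntegrable (by fun_prop) _ _
    · intro θ _
      gcongr
      calc x * Real.cos θ ≤ |x * Real.cos θ| := le_abs_self _
        _ = |x| * |Real.cos θ| := abs_mul _ _
        _ ≤ |x| * 1 := by gcongr; exact Real.abs_cos_le_one θ
        _ = |x| := mul_one _
  unfold I0
  rw [one_div_mul_eq_div, div_le_iff₀ pi_pos]
  simp only [intervalIntegral.integral_const, sub_zero, smul_eq_mul] at h
  linarith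

lemma le_I0_of_angle {x δ : ℝ} (hx : 0 ≤ x) (hδ : 0 ≤ δ) (hδπ : δ ≤ π) :
    δ / π * Real.exp (x * Real.cos δ) ≤ I0 x := by
  have h : ∫ _θ in (0:ℝ)..δ, Real.exp (x * Real.cos δ) ≤
      ∫ θ in (0:ℝ)..δ, Real.exp (x * Real.cos θ) := by
    refine intervalIntegral.integral_mono_on hδ ?_ ?_ ?_
    · exact Continuous.intervalIntegrable (by fun_prop) _ _
    · exact Continuous.intervalIntegrable (by fun_prop) _ _
    · intro θ hθ
      gcongr
      exact Real.cos_le_cos_of_nonneg_of_le_pi hθ.1 hδπ hθ.2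
  have h2 : ∫ θ in (0:ℝ)..δ, Real.exp (x * Real.cos θ) ≤
      ∫ θ in (0:ℝ)..π, Real.exp (x * Real.cos θ) := by
    refine intervalIntegral.integral_mono_interval le_rfl hδ hδπ ?_ ?_
    · exact Filter.Eventually.of_forall fun θ => (Real.exp_pos _).le
    · exact Continuous.intervalIntegrable (by fun_prop) _ _
  simp only [intervalIntegral.integral_const, sub_zero, smul_eq_mul] at h
  unfold I0
  rw [one_div_mul_eq_div, div_mul_eq_mul_div]
  gcongr
  linarith

/-- `I0` of a smaller frequency is negligible against `I0` of a larger one. -/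
lemma tendsto_I0_div_I0 {r s : ℝ} (hr : 0 ≤ r) (hrs : r < s) :
    Tendsto (fun R => I0 (r * R) / I0 (s * R)) atTop (𝓝 0) := by
  have hs : 0 < s := hr.trans_lt hrs
  obtain ⟨δ, ⟨hδ, hδπ⟩, hcos⟩ : ∃ δ, (0 < δ ∧ δ ≤ π) ∧ r < s * Real.cos δ := by
    have h1 : ∀ᶠ δ in 𝓝[>] (0:ℝ), r < s * Real.cos δ := by
      have : Tendsto (fun δ => s * Real.cos δ) (𝓝 0) (𝓝 (s * Real.cos 0)) :=
        (by fun_prop : Continuous fun δ => s * Real.cos δ).tendsto 0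
      rw [Real.cos_zero, mul_one] at this
      exact nhdsWithin_le_nhds (this.eventually (lt_mem_nhds hrs))
    have h2 : ∀ᶠ δ in 𝓝[>] (0:ℝ), δ ∈ Ioc 0 π := Ioc_mem_nhdsGT pi_pos
    obtain ⟨δ, h, h'⟩ := (h1.and h2).exists
    exact ⟨δ, h', h⟩
  have hlim : Tendsto (fun R => π / δ * Real.exp (-((s * Real.cos δ - r) * R))) atTop (𝓝 0) := by
    have : Tendsto (fun R => (s * Real.cos δ - r) * R) atTop atTop :=
      tendsto_id.const_mul_atTop (by linarith)
    simpa using (Real.tendsto_exp_neg_atTop_nhds_zero.comp this).const_mul (π / δ)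
  refine squeeze_zero' (Eventually.of_forall fun R => (div_pos (I0_pos _) (I0_pos _)).le) ?_ hlim
  filter_upwards [eventually_ge_atTop 0] with R hR
  have h1 := I0_le_exp_abs (r * R)
  rw [abs_of_nonneg (by positivity)] at h1
  have h2 := le_I0_of_angle (x := s * R) (by positivity) hδ.le hδπ
  calc I0 (r * R) / I0 (s * R)
      ≤ Real.exp (r * R) / (δ / π * Real.exp (s * R * Real.cos δ)) := by gcongr
    _ = π / δ * Real.exp (-((s * Real.cos δ - r) * R)) := by
      have : -((s * Real.cos δ - r) * R) = r * R - s * R * Real.cos δ := by ring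
      rw [this, Real.exp_sub]
      field_simp

/-- The functions `R ↦ I0 (r R)`, `r ≥ 0`, are linearly independent on `(0, ∞)`. -/
lemma eq_zero_of_sum_I0_eq_zero (S : Finset ℝ) (c : ℝ → ℝ) (hS : ∀ r ∈ S, 0 ≤ r)
    (h : ∀ R > 0, ∑ r ∈ S, c r * I0 (r * R) = 0) : ∀ r ∈ S, c r = 0 := by
  induction S using Finset.induction_on_max with
  | empty => simp
  | insert s S hmax ih =>
    have hs : s ∉ S := fun hs => lt_irrefl _ (hmax s hs)
    have hcs : c s = 0 := by
      have hlim : Tendsto (fun R => c s + ∑ r ∈ S, c r * (I0 (r * R) / I0 (s * R))) atTop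
          (𝓝 (c s + ∑ r ∈ S, c r * 0)) :=
        tendsto_const_nhds.add (tendsto_finsetSum _ fun r hr =>
          (tendsto_I0_div_I0 (hS r (Finset.mem_insert_of_mem hr)) (hmax r hr)).const_mul _)
      have h0 : Tendsto (fun R => c s + ∑ r ∈ S, c r * (I0 (r * R) / I0 (s * R))) atTop (𝓝 0) := by
        refine tendsto_const_nhds.congr' ?_
        filter_upwards [eventually_gt_atTop 0] with R hR
        have := h R hR
        rw [Finset.sum_insert hs] at this
        have h3 : c s + ∑ r ∈ S, c r * (I0 (r * R) / I0 (s * R)) =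
            (c s * I0 (s * R) + ∑ r ∈ S, c r * I0 (r * R)) / I0 (s * R) := by
          rw [add_div, mul_div_cancel_right₀ _ (I0_pos _).ne', Finset.sum_div]
          simp only [mul_div_assoc]
        rw [h3, this, zero_div]
      simpa using tendsto_nhds_unique hlim h0
    intro r hr
    rcases Finset.mem_insert.1 hr with rfl | hr
    · exact hcs
    · refine ih (fun r hr => hS r (Finset.mem_insert_of_mem hr)) (fun R hR => ?_) r hr
      simpa [Finset.sum_insert hs, hcs] using h R hR

/-! ### The reference measure and the reduced kernel -/

/-- The Rayleigh distribution, with density `R e^{-R²/2}` on `(0, ∞)`. -/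
noncomputable def rayleigh : Measure ℝ :=
  (volume.restrict (Ioi 0)).withDensity fun R => ENNReal.ofReal (R * Real.exp (-R ^ 2 / 2))

/-- The density of the channel output with respect to the Rayleigh distribution. -/
noncomputable def redKer (R r : ℝ) : ℝ := Real.exp (-r ^ 2 / 2) * I0 (r * R)

/-- The output density relative to the Rayleigh distribution. -/
noncomputable def relDensity (μ : Measure ℝ) (R : ℝ) : ℝ := ∫ r, redKer R r ∂μ

lemma continuous_redKer : Continuous fun p : ℝ × ℝ => redKer p.1 p.2 := by
  unfold redKer
  have := continuous_I0
  fun_prop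

lemma redKer_pos (R r : ℝ) : 0 < redKer R r := mul_pos (Real.exp_pos _) (I0_pos _)

lemma Ker_eq (R r : ℝ) : Ker R r = R * Real.exp (-R ^ 2 / 2) * redKer R r := by
  unfold Ker redKer
  rw [show -(R ^ 2 + r ^ 2) / 2 = -R ^ 2 / 2 + -r ^ 2 / 2 by ring, Real.exp_add]
  ring

lemma redKer_le_exp {R r a : ℝ} (hR : 0 ≤ R) (hr : 0 ≤ r) (hra : r ≤ a) :
    redKer R r ≤ Real.exp (a * R) := by
  have h1 := I0_le_exp_abs (r * R)
  rw [abs_of_nonneg (by positivity)] at h1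
  have h2 : Real.exp (-r ^ 2 / 2) ≤ 1 := by
    rw [Real.exp_le_one_iff]; nlinarith [sq_nonneg r]
  calc redKer R r ≤ 1 * Real.exp (r * R) := by
        unfold redKer; gcongr; exact (I0_pos _).le
    _ ≤ Real.exp (a * R) := by rw [one_mul]; gcongr

lemma redKer_le_exp_sq {R r : ℝ} (hR : 0 ≤ R) (hr : 0 ≤ r) :
    redKer R r ≤ Real.exp (R ^ 2 / 2) := by
  have h1 := I0_le_exp_abs (r * R)
  rw [abs_of_nonneg (by positivity)] at h1
  calc redKer R r ≤ Real.exp (-r ^ 2 / 2) * Real.exp (r * R) := by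
        unfold redKer; gcongr
    _ ≤ Real.exp (R ^ 2 / 2) := by
        rw [← Real.exp_add]; gcongr; nlinarith [sq_nonneg (R - r)]

lemma le_redKer {R r a : ℝ} (hr : 0 ≤ r) (hra : r ≤ a) :
    Real.exp (-a ^ 2 / 2) ≤ redKer R r := by
  calc Real.exp (-a ^ 2 / 2) ≤ Real.exp (-r ^ 2 / 2) * 1 := by
        rw [mul_one]; gcongr
    _ ≤ redKer R r := by unfold redKer; gcongr; exact one_le_I0 _

lemma le_redKer_of_ge {R r a b : ℝ} (hR : 0 ≤ R) (hb : 0 ≤ b) (hbr : b ≤ r) (hra : r ≤ a) :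
    Real.exp (-a ^ 2 / 2) / 3 * Real.exp (b * R / 2) ≤ redKer R r := by
  have hr : 0 ≤ r := hb.trans hbr
  have h := le_I0_of_angle (x := r * R) (δ := π / 3) (by positivity) (by positivity)
    (by linarith [pi_pos])
  rw [Real.cos_pi_div_three, show π / 3 / π = 1 / 3 by field_simp] at h
  have h2 : Real.exp (b * R / 2) ≤ Real.exp (r * R * (1 / 2)) := by
    gcongr
    nlinarith [mul_le_mul_of_nonneg_right hbr hR]
  calc Real.exp (-a ^ 2 / 2) / 3 * Real.exp (b * R / 2)
      = Real.exp (-a ^ 2 / 2) * (1 / 3 * Real.exp (b * R / 2)) := by ring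
    _ ≤ Real.exp (-r ^ 2 / 2) * (1 / 3 * Real.exp (r * R * (1 / 2))) := by gcongr
    _ ≤ redKer R r := by unfold redKer; gcongr

lemma integral_rayleigh (F : ℝ → ℝ) :
    ∫ R, F R ∂rayleigh = ∫ R in Ioi (0:ℝ), R * Real.exp (-R ^ 2 / 2) * F R := by
  unfold rayleigh
  rw [integral_withDensity_eq_integral_toReal_smul (by fun_prop) (by simp)]
  refine setIntegral_congr_fun measurableSet_Ioi fun R (hR : 0 < R) => ?_
  simp only [smul_eq_mul]
  rw [ENNReal.toReal_ofReal (by positivity)]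

lemma ae_rayleigh_of_forall {p : ℝ → Prop} (h : ∀ R > 0, p R) : ∀ᵐ R ∂rayleigh, p R := by
  refine (withDensity_absolutelyContinuous _ _).ae_le ?_
  filter_upwards [ae_restrict_mem measurableSet_Ioi] with R hR using h R hR

lemma ae_of_ae_rayleigh {p : ℝ → Prop} (h : ∀ᵐ R ∂rayleigh, p R) :
    ∀ᵐ R ∂(volume.restrict (Ioi (0:ℝ))), p R := by
  unfold rayleigh at h
  rw [ae_withDensity_iff (by fun_prop)] at h
  filter_upwards [h, ae_restrict_mem measurableSet_Ioi] with R hR (hR0 : 0 < R)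
  refine hR ?_
  rw [Ne, ENNReal.ofReal_eq_zero, not_le]
  positivity

lemma integrable_exp_rayleigh (c : ℝ) : Integrable (fun R => Real.exp (c * R)) rayleigh := by
  unfold rayleigh
  rw [integrable_withDensity_iff_integrable_smul' (by fun_prop) (by simp)]
  have hg : Integrable (fun R : ℝ => Real.exp ((c + 1) ^ 2) * Real.exp (-(1 / 4) * R ^ 2))
      (volume.restrict (Ioi 0)) :=
    ((integrable_exp_neg_mul_sq (by norm_num)).const_mul _).restrict
  refine hg.mono' (Measurable.aestronglyMeasurable (by fun_prop)) ?_
  filter_upwards [ae_restrict_mem measurableSet_Ioi] with R (hR : 0 < R)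
  rw [ENNReal.toReal_ofReal (by positivity), smul_eq_mul, Real.norm_of_nonneg (by positivity),
    ← Real.exp_add]
  calc R * Real.exp (-R ^ 2 / 2) * Real.exp (c * R)
      ≤ Real.exp R * Real.exp (-R ^ 2 / 2) * Real.exp (c * R) := by
        gcongr; linarith [Real.add_one_le_exp R]
    _ = Real.exp (R + -R ^ 2 / 2 + c * R) := by rw [Real.exp_add, Real.exp_add]
    _ ≤ _ := by
      refine Real.exp_le_exp.2 ?_
      nlinarith [sq_nonneg (R / 2 - (c + 1))]

lemma sq_le_two_mul_exp {R : ℝ} (hR : 0 ≤ R) : R ^ 2 ≤ 2 * Real.exp R := by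
  linarith [Real.quadratic_le_exp_of_nonneg hR]

lemma integrable_rayleigh_of_le {F : ℝ → ℝ} (hF : AEStronglyMeasurable F rayleigh) (C c : ℝ)
    (h : ∀ R > 0, |F R| ≤ C * Real.exp (c * R)) : Integrable F rayleigh :=
  ((integrable_exp_rayleigh c).const_mul C).mono' hF (ae_rayleigh_of_forall h)

instance : IsFiniteMeasure rayleigh := by
  have := integrable_exp_rayleigh 0
  simp only [zero_mul, Real.exp_zero] at this
  simpa [integrable_const_iff] using this

/-! ### Moments of the kernel via polar coordinates -/

lemma I0_eq_symmetric_integral (x : ℝ) :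
    I0 x = 1 / (2 * π) * ∫ θ in (-π)..π, Real.exp (x * Real.cos θ) := by
  have hi : ∀ a b, IntervalIntegrable (fun θ => Real.exp (x * Real.cos θ)) volume a b :=
    fun a b => Continuous.intervalIntegrable (by fun_prop) _ _
  have h : ∫ θ in (-π)..0, Real.exp (x * Real.cos θ) =
      ∫ θ in (0:ℝ)..π, Real.exp (x * Real.cos θ) := by
    have := intervalIntegral.integral_comp_neg (a := 0) (b := π)
      (fun θ => Real.exp (x * Real.cos θ))
    simp only [Real.cos_neg, neg_zero] at this
    exact this.symm
  rw [← intervalIntegral.integral_add_adjacent_intervals (hi (-π) 0) (hi 0 π), h, I0]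
  field_simp
  ring

lemma ofReal_redKer (R r : ℝ) :
    ENNReal.ofReal (redKer R r) = ∫⁻ θ in Ioo (-π) π,
      ENNReal.ofReal (1 / (2 * π) * Real.exp (-r ^ 2 / 2) * Real.exp (r * R * Real.cos θ)) := by
  rw [← ofReal_integral_eq_lintegral_ofReal]
  · rw [integral_const_mul, ← integral_Ioc_eq_integral_Ioo,
      ← intervalIntegral.integral_of_le (by linarith [pi_pos]), redKer, I0_eq_symmetric_integral]
    congr 1
    ring
  · refine (Continuous.integrableOn_Icc (a := -π) (b := π) ?_).mono_set Ioo_subset_Icc_self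
    fun_prop
  · exact Eventually.of_forall fun θ => by positivity

open ProbabilityTheory in
lemma lintegral_gaussian_radial (F : ℝ → ℝ≥0∞) (hF : Measurable F) (r : ℝ) :
    ∫⁻ p : ℝ × ℝ, F (√(p.1 ^ 2 + p.2 ^ 2)) ∂((gaussianReal r 1).prod (gaussianReal 0 1)) =
      ∫⁻ R in Ioi (0:ℝ), ENNReal.ofReal (R * Real.exp (-R ^ 2 / 2)) *
        (F R * ENNReal.ofReal (redKer R r)) := by
  rw [gaussianReal_of_var_ne_zero _ one_ne_zero, gaussianReal_of_var_ne_zero _ one_ne_zero,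
    prod_withDensity (by fun_prop) (by fun_prop), lintegral_withDensity_eq_lintegral_mul _
      (by fun_prop) (by fun_prop), ← Measure.volume_eq_prod, ← lintegral_comp_polarCoord_symm,
    polarCoord_target, Measure.volume_eq_prod, ← Measure.prod_restrict, lintegral_prod]
  swap
  · refine Measurable.aemeasurable ?_
    simp only [polarCoord_symm_apply, Pi.mul_apply]
    fun_prop
  refine setLIntegral_congr_fun measurableSet_Ioi fun R (hR : 0 < R) => ?_
  rw [ofReal_redKer, ← mul_assoc, ← lintegral_const_mul _ (by fun_prop)]
  refine lintegral_congr fun θ => ?_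
  have h : √((R * Real.cos θ) ^ 2 + (R * Real.sin θ) ^ 2) = R := by
    rw [show (R * Real.cos θ) ^ 2 + (R * Real.sin θ) ^ 2 =
      R ^ 2 * (Real.sin θ ^ 2 + Real.cos θ ^ 2) by ring, Real.sin_sq_add_cos_sq, mul_one,
      Real.sqrt_sq hR.le]
  simp only [polarCoord_symm_apply, Pi.mul_apply, h, smul_eq_mul, gaussianPDF]
  have key : gaussianPDFReal r 1 (R * Real.cos θ) * gaussianPDFReal 0 1 (R * Real.sin θ) =
      Real.exp (-R ^ 2 / 2) *
        (1 / (2 * π) * Real.exp (-r ^ 2 / 2) * Real.exp (r * R * Real.cos θ)) := by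
    simp only [gaussianPDFReal, NNReal.coe_one, mul_one, sub_zero]
    calc _ = (√(2 * π) * √(2 * π))⁻¹ * (Real.exp (-(R * Real.cos θ - r) ^ 2 / 2) *
          Real.exp (-(R * Real.sin θ) ^ 2 / 2)) := by rw [mul_inv]; ring
      _ = (2 * π)⁻¹ * (Real.exp (-R ^ 2 / 2) * Real.exp (-r ^ 2 / 2) *
          Real.exp (r * R * Real.cos θ)) := by
        rw [Real.mul_self_sqrt (by positivity), ← Real.exp_add, ← Real.exp_add, ← Real.exp_add]
        congr 2
        linear_combination (-R ^ 2 / 2) * Real.sin_sq_add_cos_sq θ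
      _ = _ := by ring
  rw [← ENNReal.ofReal_mul (gaussianPDFReal_nonneg _ _ _), key,
    ENNReal.ofReal_mul (Real.exp_pos _).le, ENNReal.ofReal_mul hR.le]
  ring

open ProbabilityTheory in
/-- Under `redKer R r ∂rayleigh`, `R` is the modulus of a Gaussian vector with mean `(r, 0)`. -/
lemma integral_mul_redKer (F : ℝ → ℝ) (hF : Measurable F) (hF0 : ∀ R ≥ 0, 0 ≤ F R) (r : ℝ) :
    ∫ R, F R * redKer R r ∂rayleigh =
      ∫ p : ℝ × ℝ, F (√(p.1 ^ 2 + p.2 ^ 2)) ∂((gaussianReal r 1).prod (gaussianReal 0 1)) := by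
  have hk : Measurable fun R => redKer R r :=
    (continuous_redKer.comp (by fun_prop : Continuous fun R : ℝ => (R, r))).measurable
  rw [integral_eq_lintegral_of_nonneg_ae (ae_rayleigh_of_forall fun R hR =>
      mul_nonneg (hF0 R hR.le) (redKer_pos R r).le) (by fun_prop),
    integral_eq_lintegral_of_nonneg_ae (Eventually.of_forall fun p => hF0 _ (Real.sqrt_nonneg _))
      (Measurable.aestronglyMeasurable (by fun_prop))]
  congr 1
  rw [lintegral_gaussian_radial (fun R => ENNReal.ofReal (F R)) (by fun_prop), rayleigh,
    lintegral_withDensity_eq_lintegral_mul _ (by fun_prop) (by fun_prop)]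
  refine setLIntegral_congr_fun measurableSet_Ioi fun R (hR : 0 < R) => ?_
  simp only [Pi.mul_apply]
  rw [ENNReal.ofReal_mul (hF0 R hR.le)]

lemma integral_redKer (r : ℝ) : ∫ R, redKer R r ∂rayleigh = 1 := by
  have := integral_mul_redKer (fun _ => 1) (by fun_prop) (by simp) r
  simpa using this

open ProbabilityTheory in
lemma integral_sq_gaussianReal (r : ℝ) : ∫ x, x ^ 2 ∂(gaussianReal r 1) = r ^ 2 + 1 := by
  have h := variance_fun_id_gaussianReal (μ := r) (v := 1)
  rw [variance_eq_sub (X := fun x => x) (memLp_id_gaussianReal' 2 (by simp))] at h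
  simp only [Pi.pow_apply, integral_id_gaussianReal] at h
  simp at h
  linarith

open ProbabilityTheory in
lemma integrable_sq_gaussianReal (r : ℝ) : Integrable (fun x => x ^ 2) (gaussianReal r 1) :=
  (memLp_id_gaussianReal' 2 (by simp)).integrable_sq

open ProbabilityTheory in
lemma integral_sq_mul_redKer (r : ℝ) : ∫ R, R ^ 2 * redKer R r ∂rayleigh = r ^ 2 + 2 := by
  rw [integral_mul_redKer (fun R => R ^ 2) (by fun_prop) (fun R _ => sq_nonneg R)]
  have h : ∀ p : ℝ × ℝ, √(p.1 ^ 2 + p.2 ^ 2) ^ 2 = p.1 ^ 2 + p.2 ^ 2 := fun p =>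
    Real.sq_sqrt (by positivity)
  simp only [h]
  rw [integral_add ((integrable_sq_gaussianReal r).comp_fst _)
    ((integrable_sq_gaussianReal 0).comp_snd _),
    integral_fun_fst (fun x : ℝ => x ^ 2), integral_fun_snd (fun x : ℝ => x ^ 2),
    integral_sq_gaussianReal, integral_sq_gaussianReal]
  simp
  ring

open ProbabilityTheory in
lemma le_integral_id_mul_redKer (r : ℝ) : r ≤ ∫ R, R * redKer R r ∂rayleigh := by
  rw [integral_mul_redKer (fun R => R) (by fun_prop) (fun R hR => hR)]
  have h1 : Integrable (fun x : ℝ => x) (gaussianReal r 1) :=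
    (memLp_id_gaussianReal' 1 (by simp)).integrable le_rfl
  have hr : ∫ p : ℝ × ℝ, p.1 ∂((gaussianReal r 1).prod (gaussianReal 0 1)) = r := by
    rw [integral_fun_fst (fun x : ℝ => x), integral_id_gaussianReal]; simp
  have hint : Integrable (fun p : ℝ × ℝ => 1 + (p.1 ^ 2 + p.2 ^ 2))
      ((gaussianReal r 1).prod (gaussianReal 0 1)) :=
    (integrable_const _).add (((integrable_sq_gaussianReal r).comp_fst _).add
      ((integrable_sq_gaussianReal 0).comp_snd _))
  have hint' : Integrable (fun p : ℝ × ℝ => √(p.1 ^ 2 + p.2 ^ 2))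
      ((gaussianReal r 1).prod (gaussianReal 0 1)) := by
    refine hint.mono' (by fun_prop) (Eventually.of_forall fun p => ?_)
    rw [Real.norm_of_nonneg (Real.sqrt_nonneg _)]
    nlinarith [Real.sq_sqrt (show 0 ≤ p.1 ^ 2 + p.2 ^ 2 by positivity),
      Real.sqrt_nonneg (p.1 ^ 2 + p.2 ^ 2), sq_nonneg (√(p.1 ^ 2 + p.2 ^ 2) - 1)]
  conv_lhs => rw [← hr]
  refine integral_mono (h1.comp_fst _) hint' fun p => ?_
  exact Real.le_sqrt_of_sq_le (by nlinarith [sq_nonneg p.2])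

/-! ### Output densities of amplitude-limited inputs -/

section Density

variable {a : ℝ} {μ : Measure ℝ}

lemma integrable_of_continuous_of_ae_mem_Icc [IsFiniteMeasure μ] (hμ : ∀ᵐ r ∂μ, r ∈ Icc 0 a)
    {f : ℝ → ℝ} (hf : Continuous f) : Integrable f μ := by
  rw [← Measure.restrict_eq_self_of_ae_mem hμ]
  exact hf.continuousOn.integrableOn_compact isCompact_Icc

lemma continuous_redKer_right (R : ℝ) : Continuous (redKer R) :=
  continuous_redKer.comp (by fun_prop : Continuous fun r : ℝ => (R, r))

lemma continuous_redKer_left (r : ℝ) : Continuous fun R => redKer R r :=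
  continuous_redKer.comp (by fun_prop : Continuous fun R : ℝ => (R, r))

lemma integrable_redKer [IsFiniteMeasure μ] (hμ : ∀ᵐ r ∂μ, r ∈ Icc 0 a) (R : ℝ) :
    Integrable (redKer R) μ :=
  integrable_of_continuous_of_ae_mem_Icc hμ (continuous_redKer_right R)

lemma continuous_relDensity [IsFiniteMeasure μ] (hμ : ∀ᵐ r ∂μ, r ∈ Icc 0 a) :
    Continuous (relDensity μ) := by
  have h := continuous_parametric_integral_of_continuous (μ := μ) (f := redKer) continuous_redKer
    (isCompact_Icc (a := 0) (b := a))
  rwa [Measure.restrict_eq_self_of_ae_mem hμ] at h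

lemma le_relDensity [IsProbabilityMeasure μ] (hμ : ∀ᵐ r ∂μ, r ∈ Icc 0 a) (R : ℝ) :
    Real.exp (-a ^ 2 / 2) ≤ relDensity μ R := by
  have := integral_mono_ae (integrable_const _) (integrable_redKer hμ R)
    (hμ.mono fun r hr => le_redKer (R := R) hr.1 hr.2)
  simpa [relDensity] using this

lemma relDensity_pos [IsProbabilityMeasure μ] (hμ : ∀ᵐ r ∂μ, r ∈ Icc 0 a) (R : ℝ) :
    0 < relDensity μ R := (Real.exp_pos _).trans_le (le_relDensity hμ R)

lemma relDensity_le_exp [IsProbabilityMeasure μ] (hμ : ∀ᵐ r ∂μ, r ∈ Icc 0 a) {R : ℝ}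
    (hR : 0 ≤ R) : relDensity μ R ≤ Real.exp (a * R) := by
  have := integral_mono_ae (integrable_redKer hμ R) (integrable_const _)
    (hμ.mono fun r hr => redKer_le_exp hR hr.1 hr.2)
  simpa [relDensity] using this

lemma relDensity_le_exp_sq [IsProbabilityMeasure μ] (hμ : ∀ᵐ r ∂μ, r ∈ Icc 0 a) {R : ℝ}
    (hR : 0 ≤ R) : relDensity μ R ≤ Real.exp (R ^ 2 / 2) := by
  have := integral_mono_ae (integrable_redKer hμ R) (integrable_const _)
    (hμ.mono fun r hr => redKer_le_exp_sq hR hr.1)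
  simpa [relDensity] using this

/-- The information density `-ln (f_μ(R) / R)`, expressed through `relDensity`. -/
noncomputable def infoDensity (μ : Measure ℝ) (R : ℝ) : ℝ :=
  R ^ 2 / 2 - Real.log (relDensity μ R)

lemma continuous_infoDensity [IsProbabilityMeasure μ] (hμ : ∀ᵐ r ∂μ, r ∈ Icc 0 a) :
    Continuous (infoDensity μ) := by
  unfold infoDensity
  have h := (continuous_relDensity hμ).log fun R => (relDensity_pos hμ R).ne'
  fun_prop

lemma infoDensity_nonneg [IsProbabilityMeasure μ] (hμ : ∀ᵐ r ∂μ, r ∈ Icc 0 a) {R : ℝ}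
    (hR : 0 ≤ R) : 0 ≤ infoDensity μ R := by
  have := (Real.log_le_iff_le_exp (relDensity_pos hμ R)).2 (relDensity_le_exp_sq hμ hR)
  unfold infoDensity
  linarith

lemma infoDensity_le [IsProbabilityMeasure μ] (hμ : ∀ᵐ r ∂μ, r ∈ Icc 0 a) (R : ℝ) :
    infoDensity μ R ≤ R ^ 2 / 2 + a ^ 2 / 2 := by
  have := (Real.le_log_iff_exp_le (relDensity_pos hμ R)).2 (le_relDensity hμ R)
  unfold infoDensity
  linarith

lemma le_infoDensity [IsProbabilityMeasure μ] (hμ : ∀ᵐ r ∂μ, r ∈ Icc 0 a) {R : ℝ}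
    (hR : 0 ≤ R) : R ^ 2 / 2 - a * R ≤ infoDensity μ R := by
  have := (Real.log_le_iff_le_exp (relDensity_pos hμ R)).2 (relDensity_le_exp hμ hR)
  unfold infoDensity
  linarith

lemma abs_infoDensity_le_exp [IsProbabilityMeasure μ] (hμ : ∀ᵐ r ∂μ, r ∈ Icc 0 a) {R : ℝ}
    (hR : 0 ≤ R) : |infoDensity μ R| ≤ (1 + a ^ 2 / 2) * Real.exp R := by
  rw [abs_of_nonneg (infoDensity_nonneg hμ hR)]
  have h1 := infoDensity_le hμ R
  have h2 := sq_le_two_mul_exp hR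
  have h3 := Real.one_le_exp hR
  nlinarith [mul_le_mul_of_nonneg_left h3 (sq_nonneg a)]

lemma integrable_relDensity_mul [IsProbabilityMeasure μ] (hμ : ∀ᵐ r ∂μ, r ∈ Icc 0 a)
    {F : ℝ → ℝ} (hF : AEStronglyMeasurable F rayleigh) {C c : ℝ}
    (h : ∀ R > 0, |F R| ≤ C * Real.exp (c * R)) :
    Integrable (fun R => relDensity μ R * F R) rayleigh := by
  refine integrable_rayleigh_of_le ((continuous_relDensity hμ).aestronglyMeasurable.mul hF)
    C (a + c) fun R hR => ?_
  rw [abs_mul, abs_of_pos (relDensity_pos hμ R), add_mul, Real.exp_add]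
  calc relDensity μ R * |F R| ≤ Real.exp (a * R) * (C * Real.exp (c * R)) :=
        mul_le_mul (relDensity_le_exp hμ hR.le) (h R hR) (abs_nonneg _) (Real.exp_pos _).le
    _ = _ := by ring

lemma integrable_relDensity [IsProbabilityMeasure μ] (hμ : ∀ᵐ r ∂μ, r ∈ Icc 0 a) :
    Integrable (relDensity μ) rayleigh := by
  simpa using integrable_relDensity_mul hμ (F := fun _ => 1) (by fun_prop) (C := 1) (c := 0)
    (by simp)

lemma Hout_eq [IsProbabilityMeasure μ] (hμ : ∀ᵐ r ∂μ, r ∈ Icc 0 a) :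
    Hout μ = ∫ R, relDensity μ R * infoDensity μ R ∂rayleigh := by
  rw [Hout, integral_rayleigh, ← integral_neg]
  refine setIntegral_congr_fun measurableSet_Ioi fun R (hR : 0 < R) => ?_
  have h1 : fout μ R = R * Real.exp (-R ^ 2 / 2) * relDensity μ R := by
    simp only [fout, relDensity, Ker_eq, integral_const_mul]
  have h2 : fout μ R / R = Real.exp (-R ^ 2 / 2) * relDensity μ R := by
    rw [h1]; field_simp
  rw [h2, Real.log_mul (Real.exp_pos _).ne' (relDensity_pos hμ R).ne', Real.log_exp, h1,
    infoDensity]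
  ring

/-- The marginal entropy density. -/
noncomputable def marginalEntropy (μ : Measure ℝ) (r : ℝ) : ℝ :=
  ∫ R, redKer R r * infoDensity μ R ∂rayleigh

lemma integrable_redKer_mul {F : ℝ → ℝ} (hF : AEStronglyMeasurable F rayleigh) {C c : ℝ}
    (h : ∀ R > 0, |F R| ≤ C * Real.exp (c * R)) {r : ℝ} (hr : 0 ≤ r) :
    Integrable (fun R => redKer R r * F R) rayleigh := by
  refine integrable_rayleigh_of_le ((continuous_redKer_left r).aestronglyMeasurable.mul hF)
    C (r + c) fun R hR => ?_
  rw [abs_mul, abs_of_pos (redKer_pos R r), add_mul, Real.exp_add]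
  calc redKer R r * |F R| ≤ Real.exp (r * R) * (C * Real.exp (c * R)) :=
        mul_le_mul (redKer_le_exp hR.le hr le_rfl) (h R hR) (abs_nonneg _) (Real.exp_pos _).le
    _ = _ := by ring

lemma integrable_prod_redKer [IsFiniteMeasure μ] (hμ : ∀ᵐ r ∂μ, r ∈ Icc 0 a) {φ L : ℝ → ℝ}
    (hφ : Measurable φ) {M : ℝ} (hM : ∀ᵐ r ∂μ, |φ r| ≤ M) (hL : Measurable L) {C c : ℝ}
    (h : ∀ R > 0, |L R| ≤ C * Real.exp (c * R)) :
    Integrable (fun p : ℝ × ℝ => redKer p.1 p.2 * φ p.2 * L p.1) (rayleigh.prod μ) := by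
  have hk : Measurable fun p : ℝ × ℝ => redKer p.1 p.2 := continuous_redKer.measurable
  refine Integrable.mono' (((integrable_exp_rayleigh (a + c)).const_mul (M * C)).comp_fst μ)
    (Measurable.aestronglyMeasurable (by fun_prop)) ?_
  have hR : ∀ᵐ R ∂rayleigh, 0 < R := ae_rayleigh_of_forall fun R hR => hR
  filter_upwards [Measure.quasiMeasurePreserving_fst.ae hR,
    Measure.quasiMeasurePreserving_snd.ae hμ, Measure.quasiMeasurePreserving_snd.ae hM]
    with p hp1 hp2 hp3
  rw [norm_mul, norm_mul, Real.norm_eq_abs, Real.norm_eq_abs, Real.norm_eq_abs,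
    abs_of_pos (redKer_pos _ _), add_mul, Real.exp_add]
  calc redKer p.1 p.2 * |φ p.2| * |L p.1|
      ≤ Real.exp (a * p.1) * M * (C * Real.exp (c * p.1)) := by
        have := redKer_le_exp hp1.le hp2.1 hp2.2
        have hM0 : 0 ≤ M := (abs_nonneg _).trans hp3
        gcongr
        exact h _ hp1
    _ = _ := by ring

lemma integral_integral_redKer_swap [IsFiniteMeasure μ] (hμ : ∀ᵐ r ∂μ, r ∈ Icc 0 a)
    {φ L : ℝ → ℝ} (hφ : Measurable φ) {M : ℝ} (hM : ∀ᵐ r ∂μ, |φ r| ≤ M) (hL : Measurable L)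
    {C c : ℝ} (h : ∀ R > 0, |L R| ≤ C * Real.exp (c * R)) :
    ∫ R, (∫ r, redKer R r * φ r ∂μ) * L R ∂rayleigh =
      ∫ r, φ r * ∫ R, redKer R r * L R ∂rayleigh ∂μ := by
  have := integral_integral_swap (f := fun R r => redKer R r * φ r * L R)
    (integrable_prod_redKer hμ hφ hM hL h)
  simp only [integral_mul_const] at this
  rw [this]
  refine integral_congr_ae (Eventually.of_forall fun r => ?_)
  simp only
  rw [← integral_const_mul]
  exact integral_congr_ae (Eventually.of_forall fun R => by simp only; ring)

lemma integral_relDensity [IsProbabilityMeasure μ] (hμ : ∀ᵐ r ∂μ, r ∈ Icc 0 a) :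
    ∫ R, relDensity μ R ∂rayleigh = 1 := by
  have := integral_integral_redKer_swap hμ (φ := fun _ => 1) (L := fun _ => 1) (M := 1) (C := 1)
    (c := 0) (by fun_prop) (by simp) (by fun_prop) (by simp)
  simpa [relDensity, integral_redKer] using this

end Density

/-! ### First-order optimality -/

section Optimality

variable {a : ℝ} {μ : Measure ℝ}

lemma integrable_mul_of_ae_le [IsFiniteMeasure μ] (hμ : ∀ᵐ r ∂μ, r ∈ Icc 0 a) {φ f : ℝ → ℝ}
    (hφ : Measurable φ) {M : ℝ} (hM : ∀ᵐ r ∂μ, |φ r| ≤ M) (hf : Continuous f) :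
    Integrable (fun r => φ r * f r) μ :=
  (integrable_of_continuous_of_ae_mem_Icc hμ hf).bdd_mul hφ.aestronglyMeasurable
    (by simpa only [Real.norm_eq_abs] using hM)

lemma integral_withDensity_one_add {t M : ℝ} {φ : ℝ → ℝ} (hφ : Measurable φ)
    (hM : ∀ᵐ r ∂μ, |φ r| ≤ M) (htM : |t| * M ≤ 1) (f : ℝ → ℝ) :
    ∫ r, f r ∂(μ.withDensity fun r => ENNReal.ofReal (1 + t * φ r)) =
      ∫ r, (1 + t * φ r) * f r ∂μ := by
  rw [integral_withDensity_eq_integral_toReal_smul (by fun_prop) (by simp)]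
  refine integral_congr_ae (hM.mono fun r hr => ?_)
  have h : |t * φ r| ≤ 1 := by
    rw [abs_mul]
    exact (mul_le_mul_of_nonneg_left hr (abs_nonneg t)).trans htM
  simp only [smul_eq_mul]
  rw [ENNReal.toReal_ofReal (by linarith [(abs_le.1 h).1])]

lemma integral_withDensity_one_add_of_continuous [IsFiniteMeasure μ]
    (hμ : ∀ᵐ r ∂μ, r ∈ Icc 0 a) {t M : ℝ} {φ : ℝ → ℝ} (hφ : Measurable φ)
    (hM : ∀ᵐ r ∂μ, |φ r| ≤ M) (htM : |t| * M ≤ 1) {f : ℝ → ℝ} (hf : Continuous f) :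
    ∫ r, f r ∂(μ.withDensity fun r => ENNReal.ofReal (1 + t * φ r)) =
      ∫ r, f r ∂μ + t * ∫ r, φ r * f r ∂μ := by
  rw [integral_withDensity_one_add hφ hM htM, ← integral_const_mul,
    ← integral_add (integrable_of_continuous_of_ae_mem_Icc hμ hf)
      ((integrable_mul_of_ae_le hμ hφ hM hf).const_mul t)]
  congr 1
  ext r
  ring

lemma isProbabilityMeasure_withDensity_one_add [IsProbabilityMeasure μ] {t M : ℝ} {φ : ℝ → ℝ}
    (hφ : Measurable φ) (hM : ∀ᵐ r ∂μ, |φ r| ≤ M) (htM : |t| * M ≤ 1) (hφ0 : ∫ r, φ r ∂μ = 0) :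
    IsProbabilityMeasure (μ.withDensity fun r => ENNReal.ofReal (1 + t * φ r)) := by
  have hint : Integrable φ μ := (integrable_const M).mono' hφ.aestronglyMeasurable
    (by simpa only [Real.norm_eq_abs] using hM)
  have hint' : Integrable (fun r => 1 + t * φ r) μ := (integrable_const 1).add (hint.const_mul t)
  constructor
  rw [withDensity_apply _ MeasurableSet.univ, Measure.restrict_univ,
    ← ofReal_integral_eq_lintegral_ofReal hint']
  · rw [integral_add (integrable_const 1) (hint.const_mul t), integral_const_mul, hφ0]
    simp
  · refine hM.mono fun r hr => ?_
    have h : |t * φ r| ≤ 1 := by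
      rw [abs_mul]
      exact (mul_le_mul_of_nonneg_left hr (abs_nonneg t)).trans htM
    simp only [Pi.zero_apply]
    linarith [(abs_le.1 h).1]

lemma Hout_withDensity_one_add_ge [IsProbabilityMeasure μ] (hμ : ∀ᵐ r ∂μ, r ∈ Icc 0 a)
    {t M : ℝ} {φ : ℝ → ℝ} (hφ : Measurable φ) (hM : ∀ᵐ r ∂μ, |φ r| ≤ M) (htM : |t| * M ≤ 1)
    (hφ0 : ∫ r, φ r ∂μ = 0) :
    Hout μ + t * ∫ r, φ r * marginalEntropy μ r ∂μ - t ^ 2 * M ^ 2 ≤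
      Hout (μ.withDensity fun r => ENNReal.ofReal (1 + t * φ r)) := by
  have hP := isProbabilityMeasure_withDensity_one_add hφ hM htM hφ0
  set ν := μ.withDensity fun r => ENNReal.ofReal (1 + t * φ r) with hν
  have hνs : ∀ᵐ r ∂ν, r ∈ Icc 0 a := (withDensity_absolutelyContinuous _ _).ae_le hμ
  set U : ℝ → ℝ := fun R => ∫ r, redKer R r * φ r ∂μ with hU
  have hW : ∀ R, relDensity ν R = relDensity μ R + t * U R := fun R => by
    simp only [relDensity, hU, mul_comm _ (φ _)]
    exact integral_withDensity_one_add_of_continuous hμ hφ hM htM (continuous_redKer_right R)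
  have hU_le : ∀ R, |U R| ≤ M * relDensity μ R := fun R => by
    rw [relDensity, ← integral_const_mul]
    refine norm_integral_le_of_norm_le (f := fun r => redKer R r * φ r)
      ((integrable_redKer hμ R).const_mul M) (hM.mono fun r hr => ?_)
    rw [norm_mul, Real.norm_eq_abs, Real.norm_eq_abs, abs_of_pos (redKer_pos R r), mul_comm]
    exact mul_le_mul_of_nonneg_right hr (redKer_pos R r).le
  have hUm : Measurable U := by
    refine StronglyMeasurable.measurable (StronglyMeasurable.integral_prod_right'
      (f := fun p : ℝ × ℝ => redKer p.1 p.2 * φ p.2) ?_)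
    have hk : Measurable fun p : ℝ × ℝ => redKer p.1 p.2 := continuous_redKer.measurable
    exact Measurable.stronglyMeasurable (by fun_prop)
  have hLm : Continuous (infoDensity μ) := continuous_infoDensity hμ
  have hLb : ∀ R > 0, |infoDensity μ R| ≤ (1 + a ^ 2 / 2) * Real.exp (1 * R) := fun R hR => by
    rw [one_mul]; exact abs_infoDensity_le_exp hμ hR.le
  have hU0 : ∫ R, U R ∂rayleigh = 0 := by
    have := integral_integral_redKer_swap hμ hφ hM (L := fun _ => 1) (C := 1) (c := 0)
      (by fun_prop) (by simp)
    simpa [integral_redKer, hφ0] using this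
  have hUL : ∫ R, U R * infoDensity μ R ∂rayleigh = ∫ r, φ r * marginalEntropy μ r ∂μ :=
    integral_integral_redKer_swap hμ hφ hM hLm.measurable hLb
  have hWi := integrable_relDensity hμ
  have hWLi := integrable_relDensity_mul hμ hLm.aestronglyMeasurable hLb
  have hUi : Integrable U rayleigh := (hWi.const_mul M).mono' hUm.aestronglyMeasurable
    (Eventually.of_forall hU_le)
  have hULi : Integrable (fun R => U R * infoDensity μ R) rayleigh := by
    refine (hWLi.norm.const_mul M).mono' (hUm.mul hLm.measurable).aestronglyMeasurable
      (Eventually.of_forall fun R => ?_)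
    rw [norm_mul, norm_mul, ← mul_assoc, Real.norm_of_nonneg (relDensity_pos hμ R).le]
    exact mul_le_mul_of_nonneg_right (hU_le R) (norm_nonneg _)
  rw [Hout_eq hμ, Hout_eq hνs]
  have hpt : ∀ R, relDensity μ R * infoDensity μ R + t * (U R * infoDensity μ R) - t * U R
      - t ^ 2 * M ^ 2 * relDensity μ R ≤ relDensity ν R * infoDensity ν R := fun R => by
    have hp := relDensity_pos hμ R
    have hq := relDensity_pos hνs R
    have hlog : Real.log (relDensity ν R) ≤
        Real.log (relDensity μ R) + t * U R / relDensity μ R := by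
      have h1 := Real.log_le_sub_one_of_pos (div_pos hq hp)
      rw [Real.log_div hq.ne' hp.ne'] at h1
      have h2 : relDensity ν R / relDensity μ R - 1 = t * U R / relDensity μ R := by
        rw [hW]; field_simp; ring
      linarith
    have h3 : relDensity ν R * (t * U R / relDensity μ R) ≤
        t * U R + t ^ 2 * M ^ 2 * relDensity μ R := by
      have h4 : relDensity ν R * (t * U R / relDensity μ R) =
          t * U R + t ^ 2 * (U R ^ 2 / relDensity μ R) := by
        rw [hW]; field_simp
      have h5 : U R ^ 2 / relDensity μ R ≤ M ^ 2 * relDensity μ R := by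
        rw [div_le_iff₀ hp]
        calc U R ^ 2 = |U R| ^ 2 := (sq_abs _).symm
          _ ≤ (M * relDensity μ R) ^ 2 := by gcongr; exact hU_le R
          _ = _ := by ring
      rw [h4]
      nlinarith [mul_le_mul_of_nonneg_left h5 (sq_nonneg t)]
    have h6 := mul_le_mul_of_nonneg_left hlog hq.le
    have h7 : relDensity μ R * infoDensity μ R + t * (U R * infoDensity μ R) =
        relDensity ν R * infoDensity μ R := by rw [hW]; ring
    rw [h7]
    unfold infoDensity
    linarith
  have hνi := integrable_relDensity_mul hνs (continuous_infoDensity hνs).aestronglyMeasurable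
    (C := 1 + a ^ 2 / 2) (c := 1)
    (fun R hR => by rw [one_mul]; exact abs_infoDensity_le_exp hνs hR.le)
  have hi1 : Integrable (fun R => relDensity μ R * infoDensity μ R + t * (U R * infoDensity μ R))
    rayleigh := hWLi.add (hULi.const_mul t)
  have hi2 : Integrable (fun R => relDensity μ R * infoDensity μ R + t * (U R * infoDensity μ R) -
    t * U R) rayleigh := hi1.sub (hUi.const_mul t)
  have := integral_mono (hi2.sub (hWi.const_mul (t ^ 2 * M ^ 2))) hνi hpt
  simp only [Pi.sub_apply] at this
  rw [integral_sub hi2 (hWi.const_mul (t ^ 2 * M ^ 2)), integral_const_mul,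
    integral_relDensity hμ, integral_sub hi1 (hUi.const_mul t), integral_const_mul, hU0,
    integral_add hWLi (hULi.const_mul t), integral_const_mul, hUL] at this
  linarith

/-- A maximizer of `Hout` under linear constraints is stationary along bounded densities
orthogonal to the constraint functions. -/
lemma integral_mul_marginalEntropy_eq_zero [IsProbabilityMeasure μ]
    (hμ : ∀ᵐ r ∂μ, r ∈ Icc 0 a) {ι : Type*} {f : ι → ℝ → ℝ} (hf : ∀ i, Continuous (f i))
    (hmax : ∀ ν : Measure ℝ, IsProbabilityMeasure ν → (∀ᵐ r ∂ν, r ∈ Icc 0 a) →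
      (∀ i, ∫ r, f i r ∂ν = ∫ r, f i r ∂μ) → Hout ν ≤ Hout μ)
    {M : ℝ} {φ : ℝ → ℝ} (hφ : Measurable φ) (hM : ∀ᵐ r ∂μ, |φ r| ≤ M)
    (hφ0 : ∫ r, φ r ∂μ = 0) (hφf : ∀ i, ∫ r, φ r * f i r ∂μ = 0) :
    ∫ r, φ r * marginalEntropy μ r ∂μ = 0 := by
  set I := ∫ r, φ r * marginalEntropy μ r ∂μ with hI
  have hM0 : 0 ≤ M := by
    obtain ⟨r, hr⟩ := hM.exists
    exact (abs_nonneg _).trans hr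
  have key : ∀ t, |t| * M ≤ 1 → t * I ≤ t ^ 2 * M ^ 2 := fun t ht => by
    have h1 := Hout_withDensity_one_add_ge hμ hφ hM ht hφ0
    have h2 := hmax _ (isProbabilityMeasure_withDensity_one_add hφ hM ht hφ0)
      ((withDensity_absolutelyContinuous _ _).ae_le hμ) fun i => by
        rw [integral_withDensity_one_add_of_continuous hμ hφ hM ht (hf i), hφf i]; ring
    linarith
  set D := 2 * (M ^ 2 + |I| * M + 1) with hD
  have hDpos : 0 < D := by positivity
  have h := key (I / D) (by
    rw [abs_div, abs_of_pos hDpos, div_mul_eq_mul_div, div_le_one hDpos]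
    nlinarith [mul_nonneg (abs_nonneg I) hM0, sq_nonneg M])
  have h' : I ^ 2 * D ≤ I ^ 2 * M ^ 2 := by
    have e1 : I / D * I = I ^ 2 * D / D ^ 2 := by field_simp
    have e2 : (I / D) ^ 2 * M ^ 2 = I ^ 2 * M ^ 2 / D ^ 2 := by field_simp
    rw [e1, e2] at h
    exact (div_le_div_iff_of_pos_right (by positivity)).1 h
  have : I ^ 2 ≤ 0 := by
    nlinarith [mul_nonneg (sq_nonneg I) (mul_nonneg (abs_nonneg I) hM0),
      mul_nonneg (sq_nonneg I) (sq_nonneg M)]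
  exact pow_eq_zero_iff two_ne_zero |>.1 (le_antisymm this (sq_nonneg I))

end Optimality

/-- A bounded function annihilated by every bounded density orthogonal to `f` lies in the span of
`f` almost everywhere. -/
lemma exists_ae_eq_sum_of_orthogonal {α ι : Type*} [Fintype ι] {mα : MeasurableSpace α}
    {μ : Measure α} [IsFiniteMeasure μ] {f : ι → α → ℝ} {h : α → ℝ}
    (hf : ∀ i, Measurable (f i)) (hh : Measurable h) {M : ℝ} (hfM : ∀ i, ∀ᵐ x ∂μ, |f i x| ≤ M)
    (hhM : ∀ᵐ x ∂μ, |h x| ≤ M)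
    (horth : ∀ φ : α → ℝ, Measurable φ → (∃ C, ∀ᵐ x ∂μ, |φ x| ≤ C) →
      (∀ i, ∫ x, φ x * f i x ∂μ = 0) → ∫ x, φ x * h x ∂μ = 0) :
    ∃ c : ι → ℝ, ∀ᵐ x ∂μ, h x = ∑ i, c i * f i x := by
  have hfL : ∀ i, MemLp (f i) 2 μ := fun i =>
    MemLp.of_bound (hf i).aestronglyMeasurable M (by simpa only [Real.norm_eq_abs] using hfM i)
  have hhL : MemLp h 2 μ :=
    MemLp.of_bound hh.aestronglyMeasurable M (by simpa only [Real.norm_eq_abs] using hhM)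
  let v : ι → Lp ℝ 2 μ := fun i => (hfL i).toLp
  let S : Submodule ℝ (Lp ℝ 2 μ) := Submodule.span ℝ (range v)
  have : FiniteDimensional ℝ S := FiniteDimensional.span_of_finite ℝ (finite_range v)
  obtain ⟨c, hc⟩ := (Submodule.mem_span_range_iff_exists_fun ℝ).1
    (S.starProjection_apply_mem hhL.toLp)
  refine ⟨c, ?_⟩
  let φ : α → ℝ := fun x => h x - ∑ i, c i * f i x
  have hφm : Measurable φ := by fun_prop
  have hφL : MemLp φ 2 μ := hhL.sub (memLp_finsetSum _ fun i _ => (hfL i).const_mul (c i))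
  have hφeq : hφL.toLp = hhL.toLp - S.starProjection hhL.toLp := by
    rw [← hc]
    ext1
    have h1 : ∀ᵐ x ∂μ, ∀ i, v i x = f i x := ae_all_iff.2 fun i => (hfL i).coeFn_toLp
    have h2 : ∀ᵐ x ∂μ, ∀ i, (c i • v i : Lp ℝ 2 μ) x = c i * v i x :=
      ae_all_iff.2 fun i => Lp.coeFn_smul (c i) (v i)
    filter_upwards [h1, h2, hφL.coeFn_toLp, hhL.coeFn_toLp, Lp.coeFn_sub hhL.toLp (∑ i, c i • v i),
      Lp.coeFn_fun_finsetSum Finset.univ fun i => c i • v i] with x h1 h2 h3 h4 h5 h6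
    rw [h3, h5, Pi.sub_apply, h4, h6]
    simp only [h1, h2, φ]
  have horth' : ∀ i, ∫ x, φ x * f i x ∂μ = 0 := fun i => by
    have : inner ℝ hφL.toLp (v i) = 0 := by
      rw [hφeq, real_inner_comm]
      exact S.sub_starProjection_mem_orthogonal _ _ (Submodule.subset_span (mem_range_self i))
    rw [L2.inner_def] at this
    rw [← this]
    refine integral_congr_ae ?_
    filter_upwards [hφL.coeFn_toLp, (hfL i).coeFn_toLp] with x h1 h2
    simp [v, h1, h2, mul_comm]
  have hφb : ∃ C, ∀ᵐ x ∂μ, |φ x| ≤ C := by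
    refine ⟨M + ∑ i, |c i| * M, ?_⟩
    filter_upwards [hhM, ae_all_iff.2 hfM] with x h1 h2
    refine (abs_sub _ _).trans (add_le_add h1 ((Finset.abs_sum_le_sum_abs _ _).trans ?_))
    refine Finset.sum_le_sum fun i _ => ?_
    rw [abs_mul]
    gcongr
    exact h2 i
  have h0 := horth φ hφm hφb horth'
  have hsq : ∫ x, φ x ^ 2 ∂μ = 0 := by
    have hint : ∀ i, Integrable (fun x => φ x * f i x) μ := fun i => hφL.integrable_mul (hfL i)
    have : ∀ x, φ x ^ 2 = φ x * h x - ∑ i, c i * (φ x * f i x) := fun x => by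
      have : φ x = h x - ∑ i, c i * f i x := rfl
      simp only [mul_left_comm (c _), ← Finset.mul_sum]
      rw [← mul_sub, ← this, sq]
    have hφh : Integrable (fun x => φ x * h x) μ := hφL.integrable_mul hhL
    simp only [this]
    rw [integral_sub hφh
      (integrable_finsetSum _ fun i _ => (hint i).const_mul (c i)), h0,
      integral_finsetSum _ fun i _ => (hint i).const_mul (c i)]
    simp [integral_const_mul, horth']
  rw [integral_eq_zero_iff_of_nonneg (fun x => sq_nonneg _) hφL.integrable_sq] at hsq
  filter_upwards [hsq] with x hx
  have : φ x = 0 := by simpa using hx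
  linarith [show φ x = h x - ∑ i, c i * f i x from rfl]

/-! ### Analyticity and growth of the marginal entropy density -/

section Growth

variable {a : ℝ} {μ : Measure ℝ}

open ProbabilityTheory in
lemma analyticOnNhd_marginalEntropy [IsProbabilityMeasure μ] (hμ : ∀ᵐ r ∂μ, r ∈ Icc 0 a) :
    AnalyticOnNhd ℝ (marginalEntropy μ) univ := by
  have hLm : Measurable (infoDensity μ) := (continuous_infoDensity hμ).measurable
  have hL0 : ∀ᵐ R ∂rayleigh, 0 ≤ infoDensity μ R :=
    ae_rayleigh_of_forall fun R hR => infoDensity_nonneg hμ hR.le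
  let ρ : Measure ℝ := rayleigh.withDensity fun R => ENNReal.ofReal (infoDensity μ R)
  let θm : Measure ℝ := volume.restrict (Ioc 0 π)
  let X : ℝ × ℝ → ℝ := fun p => p.1 * Real.cos p.2
  have hρ : ∀ F : ℝ → ℝ, ∫ R, F R ∂ρ = ∫ R, infoDensity μ R * F R ∂rayleigh := fun F => by
    rw [integral_withDensity_eq_integral_toReal_smul (by fun_prop) (by simp)]
    refine integral_congr_ae (hL0.mono fun R hR => ?_)
    simp only [smul_eq_mul, ENNReal.toReal_ofReal hR]
  have hρi : ∀ t, Integrable (fun R => Real.exp (t * R)) ρ := fun t => by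
    rw [integrable_withDensity_iff_integrable_smul' (by fun_prop) (by simp)]
    refine integrable_rayleigh_of_le (Measurable.aestronglyMeasurable (by fun_prop))
      (1 + a ^ 2 / 2) (t + 1) fun R hR => ?_
    have h0 := infoDensity_nonneg hμ hR.le
    have h1 := abs_infoDensity_le_exp hμ hR.le
    rw [smul_eq_mul, ENNReal.toReal_ofReal h0, abs_mul, abs_of_pos (Real.exp_pos _), add_mul t,
      Real.exp_add, one_mul]
    nlinarith [mul_le_mul_of_nonneg_right h1 (Real.exp_pos (t * R)).le]
  have hρpos : ∀ᵐ R ∂ρ, 0 < R :=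
    (withDensity_absolutelyContinuous _ _).ae_le (ae_rayleigh_of_forall fun R hR => hR)
  have hρfin : IsFiniteMeasure ρ := by
    have := hρi 0
    simp only [zero_mul, Real.exp_zero] at this
    simpa [integrable_const_iff] using this
  have hX : ∀ t, Integrable (fun p => Real.exp (t * X p)) (ρ.prod θm) := fun t => by
    refine ((hρi |t|).comp_fst θm).mono' (Measurable.aestronglyMeasurable (by fun_prop)) ?_
    filter_upwards [Measure.quasiMeasurePreserving_fst.ae hρpos] with p (hp : 0 < p.1)
    rw [Real.norm_of_nonneg (Real.exp_pos _).le]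
    refine Real.exp_le_exp.2 ((le_abs_self _).trans ?_)
    rw [abs_mul, abs_mul, abs_of_pos hp]
    have := Real.abs_cos_le_one p.2
    gcongr
    nlinarith
  have hset : integrableExpSet X (ρ.prod θm) = univ := eq_univ_of_forall hX
  have hmgf : AnalyticOnNhd ℝ (mgf X (ρ.prod θm)) univ := by
    have := analyticOnNhd_mgf (X := X) (μ := ρ.prod θm)
    rwa [hset, interior_univ] at this
  have heq : marginalEntropy μ = fun r =>
      Real.exp (-r ^ 2 / 2) * (1 / π) * mgf X (ρ.prod θm) r := by
    ext r
    rw [mgf, integral_prod _ (hX r), hρ, marginalEntropy, ← integral_const_mul]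
    refine integral_congr_ae (Eventually.of_forall fun R => ?_)
    simp only [redKer, I0, intervalIntegral.integral_of_le pi_pos.le, X, θm, mul_assoc]
    ring
  rw [heq]
  refine AnalyticOnNhd.mul ?_ hmgf
  exact fun x _ => by fun_prop

lemma le_relDensity_exp_mean [IsProbabilityMeasure μ] (hμ : ∀ᵐ r ∂μ, r ∈ Icc 0 a) {R : ℝ}
    (hR : 0 ≤ R) :
    Real.exp (-a ^ 2 / 2) / 3 * Real.exp ((∫ r, r ∂μ) * R / 2) ≤ relDensity μ R := by
  set m := ∫ r, r ∂μ with hm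
  set c := Real.exp (-a ^ 2 / 2) / 3 * Real.exp (m * R / 2) with hc
  have hid : Integrable (fun r : ℝ => r) μ :=
    integrable_of_continuous_of_ae_mem_Icc hμ continuous_id
  have hsub : Integrable (fun r => (r - m) * (R / 2)) μ :=
    (hid.sub (integrable_const m)).mul_const (R / 2)
  have hint : Integrable (fun r => c * (1 + (r - m) * (R / 2))) μ :=
    ((integrable_const 1).add hsub).const_mul c
  have h1 : ∫ r, c * (1 + (r - m) * (R / 2)) ∂μ = c := by
    rw [integral_const_mul, integral_add (integrable_const 1) hsub, integral_mul_const,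
      integral_sub hid (integrable_const m), ← hm]
    simp
  rw [← h1]
  refine integral_mono_ae hint (integrable_redKer hμ R) (hμ.mono fun r hr => ?_)
  refine le_trans ?_ (le_redKer_of_ge hR hr.1 le_rfl hr.2)
  rw [hc, show r * R / 2 = m * R / 2 + (r - m) * (R / 2) by ring, Real.exp_add, ← mul_assoc]
  refine mul_le_mul_of_nonneg_left ?_ (by positivity)
  linarith [Real.add_one_le_exp ((r - m) * (R / 2))]

lemma infoDensity_le_mean [IsProbabilityMeasure μ] (hμ : ∀ᵐ r ∂μ, r ∈ Icc 0 a) {R : ℝ}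
    (hR : 0 ≤ R) :
    infoDensity μ R ≤ R ^ 2 / 2 - (∫ r, r ∂μ) / 2 * R - Real.log (Real.exp (-a ^ 2 / 2) / 3) := by
  have h := Real.log_le_log (by positivity) (le_relDensity_exp_mean hμ hR)
  rw [Real.log_mul (by positivity) (by positivity), Real.log_exp] at h
  unfold infoDensity
  linarith

lemma integrable_id_mul_redKer {r : ℝ} (hr : 0 ≤ r) :
    Integrable (fun R => R * redKer R r) rayleigh := by
  simpa only [mul_comm] using integrable_redKer_mul (F := fun R => R) (C := 1) (c := 1)
    (by fun_prop) (fun R hR => by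
      rw [abs_of_pos hR, one_mul, one_mul]; linarith [Real.add_one_le_exp R]) hr

lemma integrable_sq_mul_redKer {r : ℝ} (hr : 0 ≤ r) :
    Integrable (fun R => R ^ 2 * redKer R r) rayleigh := by
  simpa only [mul_comm] using integrable_redKer_mul (F := fun R => R ^ 2) (C := 2) (c := 1)
    (by fun_prop) (fun R hR => by
      rw [abs_of_pos (by positivity), one_mul]; exact sq_le_two_mul_exp hR.le) hr

lemma integrable_redKer_left {r : ℝ} (hr : 0 ≤ r) :
    Integrable (fun R => redKer R r) rayleigh := by
  simpa using integrable_redKer_mul (F := fun _ => 1) (C := 1) (c := 0) (by fun_prop) (by simp) hr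

lemma integral_quadratic_mul_redKer {r : ℝ} (hr : 0 ≤ r) (A B C : ℝ) :
    Integrable (fun R => redKer R r * (A * R ^ 2 + B * R + C)) rayleigh ∧
    ∫ R, redKer R r * (A * R ^ 2 + B * R + C) ∂rayleigh =
      A * (r ^ 2 + 2) + B * (∫ R, R * redKer R r ∂rayleigh) + C := by
  have h2 := (integrable_sq_mul_redKer hr).const_mul A
  have h1 := (integrable_id_mul_redKer hr).const_mul B
  have h0 := (integrable_redKer_left hr).const_mul C
  have h21 : Integrable (fun R => A * (R ^ 2 * redKer R r) + B * (R * redKer R r)) rayleigh :=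
    h2.add h1
  have heq : (fun R => redKer R r * (A * R ^ 2 + B * R + C)) =
      fun R => A * (R ^ 2 * redKer R r) + B * (R * redKer R r) + C * redKer R r := by
    ext R; ring
  rw [heq]
  refine ⟨h21.add h0, ?_⟩
  rw [integral_add h21 h0, integral_add h2 h1, integral_const_mul, integral_const_mul,
    integral_const_mul, integral_sq_mul_redKer, integral_redKer, mul_one]

lemma integral_id_mul_redKer_le {r : ℝ} (hr : 1 ≤ r) :
    ∫ R, R * redKer R r ∂rayleigh ≤ r + 1 := by
  have hr0 : 0 < r := zero_lt_one.trans_le hr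
  obtain ⟨hi, he⟩ := integral_quadratic_mul_redKer hr0.le (1 / (2 * r)) 0 (r / 2)
  have h := integral_mono (integrable_id_mul_redKer hr0.le) hi fun R => by
    have : R ≤ 1 / (2 * r) * R ^ 2 + 0 * R + r / 2 := by
      have : 1 / (2 * r) * R ^ 2 + 0 * R + r / 2 - R = (R - r) ^ 2 / (2 * r) := by
        field_simp; ring
      have h' : 0 ≤ (R - r) ^ 2 / (2 * r) := by positivity
      linarith
    simp only [mul_comm (redKer R r)]
    exact mul_le_mul_of_nonneg_right this (redKer_pos R r).le
  rw [he] at h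
  have h1 : 1 / (2 * r) * (r ^ 2 + 2) = r / 2 + 1 / r := by field_simp
  have h2 : 1 / r ≤ 1 := by rw [div_le_one hr0]; exact hr
  linarith

lemma integrable_redKer_mul_infoDensity [IsProbabilityMeasure μ] (hμ : ∀ᵐ r ∂μ, r ∈ Icc 0 a)
    {r : ℝ} (hr : 0 ≤ r) : Integrable (fun R => redKer R r * infoDensity μ R) rayleigh :=
  integrable_redKer_mul (continuous_infoDensity hμ).aestronglyMeasurable (C := 1 + a ^ 2 / 2)
    (c := 1) (fun R hR => by rw [one_mul]; exact abs_infoDensity_le_exp hμ hR.le) hr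

lemma marginalEntropy_le [IsProbabilityMeasure μ] (hμ : ∀ᵐ r ∂μ, r ∈ Icc 0 a) {r : ℝ}
    (hr : 0 ≤ r) :
    marginalEntropy μ r ≤ r ^ 2 / 2 + 1 - (∫ x, x ∂μ) / 2 * r -
      Real.log (Real.exp (-a ^ 2 / 2) / 3) := by
  obtain ⟨hi, he⟩ := integral_quadratic_mul_redKer hr (1 / 2) (-((∫ x, x ∂μ) / 2))
    (-Real.log (Real.exp (-a ^ 2 / 2) / 3))
  have h := integral_mono_ae (integrable_redKer_mul_infoDensity hμ hr) hi
    (ae_rayleigh_of_forall fun R hR => mul_le_mul_of_nonneg_left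
      (by linarith [infoDensity_le_mean hμ hR.le]) (redKer_pos R r).le)
  rw [he] at h
  have hm : 0 ≤ ∫ x, x ∂μ := integral_nonneg_of_ae (hμ.mono fun r hr => hr.1)
  have := mul_le_mul_of_nonneg_left (le_integral_id_mul_redKer r) hm
  unfold marginalEntropy
  linarith

lemma le_marginalEntropy [IsProbabilityMeasure μ] (ha : 0 ≤ a) (hμ : ∀ᵐ r ∂μ, r ∈ Icc 0 a)
    {r : ℝ} (hr : 1 ≤ r) : r ^ 2 / 2 + 1 - a * (r + 1) ≤ marginalEntropy μ r := by
  have hr0 : 0 ≤ r := zero_le_one.trans hr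
  obtain ⟨hi, he⟩ := integral_quadratic_mul_redKer hr0 (1 / 2) (-a) 0
  have h := integral_mono_ae hi (integrable_redKer_mul_infoDensity hμ hr0)
    (ae_rayleigh_of_forall fun R hR => mul_le_mul_of_nonneg_left
      (by linarith [le_infoDensity hμ hR.le]) (redKer_pos R r).le)
  rw [he] at h
  have := mul_le_mul_of_nonneg_left (integral_id_mul_redKer_le hr) ha
  unfold marginalEntropy
  linarith

/-- The marginal entropy density of a nondegenerate input is not a polynomial in `r²`. -/
lemma not_forall_marginalEntropy_eq_eval [IsProbabilityMeasure μ] (ha : 0 ≤ a)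
    (hμ : ∀ᵐ r ∂μ, r ∈ Icc 0 a) (hm : 0 < ∫ x, x ∂μ) (P : Polynomial ℝ) :
    ¬ ∀ r, marginalEntropy μ r = P.eval (r ^ 2) := by
  intro hP
  set m := ∫ x, x ∂μ
  set A := -Real.log (Real.exp (-a ^ 2 / 2) / 3) with hA
  let Q : Polynomial ℝ := P - Polynomial.C (1 / 2) * Polynomial.X - 1
  have hQ : ∀ s, 0 ≤ s → Q.eval s = marginalEntropy μ √s - (s / 2 + 1) := fun s hs => by
    rw [hP, Real.sq_sqrt hs]
    simp [Q]
    ring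
  have hup : ∀ s, 0 ≤ s → Q.eval s ≤ A - m / 2 * √s := fun s hs => by
    have := marginalEntropy_le hμ (Real.sqrt_nonneg s)
    rw [Real.sq_sqrt hs] at this
    rw [hQ s hs]
    linarith
  have hlo : ∀ s, 1 ≤ s → -(2 * a * √s) ≤ Q.eval s := fun s hs => by
    have h1 : 1 ≤ √s := Real.one_le_sqrt.2 hs
    have := le_marginalEntropy ha hμ h1
    rw [Real.sq_sqrt (by linarith)] at this
    rw [hQ s (by linarith)]
    nlinarith
  have hlim : Tendsto (fun s => Q.eval s / (Polynomial.X : Polynomial ℝ).eval s) atTop (𝓝 0) := by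
    have hsq : Tendsto (fun s => -(2 * a) * (√s)⁻¹) atTop (𝓝 0) := by
      simpa using (tendsto_inv_atTop_zero.comp Real.tendsto_sqrt_atTop).const_mul (-(2 * a))
    have hinv : Tendsto (fun s : ℝ => A * s⁻¹) atTop (𝓝 0) := by
      simpa using tendsto_inv_atTop_zero.const_mul A
    refine tendsto_of_tendsto_of_tendsto_of_le_of_le' hsq hinv ?_ ?_
    · filter_upwards [eventually_ge_atTop 1] with s hs
      have hs0 : 0 < s := by linarith
      rw [Polynomial.eval_X, le_div_iff₀ hs0]
      have : -(2 * a) * (√s)⁻¹ * s = -(2 * a * √s) := by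
        have h0 : √s ≠ 0 := (Real.sqrt_pos.2 hs0).ne'
        field_simp
        rw [Real.sq_sqrt hs0.le]
      rw [this]
      exact hlo s hs
    · filter_upwards [eventually_ge_atTop 1] with s hs
      have hs0 : 0 < s := by linarith
      rw [Polynomial.eval_X, div_le_iff₀ hs0, mul_assoc, inv_mul_cancel₀ hs0.ne', mul_one]
      have := hup s hs0.le
      nlinarith [mul_nonneg hm.le (Real.sqrt_nonneg s)]
  have hdeg := (Polynomial.div_tendsto_atTop_zero_iff_degree_lt Q _ Polynomial.X_ne_zero).1 hlim
  rw [Polynomial.degree_X] at hdeg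
  have hconst := Polynomial.eq_C_of_degree_le_zero
    (Nat.WithBot.lt_one_iff_le_zero.1 hdeg)
  obtain ⟨s, hs0, hs⟩ : ∃ s, 0 ≤ s ∧ A - Q.coeff 0 < m / 2 * √s := by
    have := (Real.tendsto_sqrt_atTop.const_mul_atTop (half_pos hm)).eventually_gt_atTop
      (A - Q.coeff 0)
    exact ((eventually_ge_atTop 0).and this).exists
  have := hup s hs0
  rw [hconst, Polynomial.eval_C] at this
  linarith

/-- An input whose marginal entropy density agrees almost everywhere with a polynomial in `r²` is
supported on a finite set. -/
lemma exists_finset_of_marginalEntropy_eq_eval [IsProbabilityMeasure μ] (ha : 0 ≤ a)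
    (hμ : ∀ᵐ r ∂μ, r ∈ Icc 0 a) (P : Polynomial ℝ)
    (hP : ∀ᵐ r ∂μ, marginalEntropy μ r = P.eval (r ^ 2)) :
    ∃ s : Finset ℝ, μ ((s : Set ℝ))ᶜ = 0 := by
  have hm0 : 0 ≤ ∫ x, x ∂μ := integral_nonneg_of_ae (hμ.mono fun r hr => hr.1)
  rcases hm0.eq_or_lt with hm | hm
  · refine ⟨{0}, ?_⟩
    have := (integral_eq_zero_iff_of_nonneg_ae (hμ.mono fun r hr => hr.1)
      (integrable_of_continuous_of_ae_mem_Icc hμ continuous_id)).1 hm.symm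
    rw [← mem_ae_iff]
    filter_upwards [this] with r hr
    simpa using hr
  · set Z := {r | r ∈ Icc 0 a ∧ marginalEntropy μ r = P.eval (r ^ 2)} with hZ
    have hZfin : Z.Finite := by
      by_contra hinf
      obtain ⟨x, -, hx⟩ := Set.Infinite.exists_accPt_of_subset_isCompact hinf isCompact_Icc
        (fun r hr => hr.1)
      have hPan : AnalyticOnNhd ℝ (fun r : ℝ => P.eval (r ^ 2)) univ := by
        have hsq : AnalyticOnNhd ℝ (fun r : ℝ => r ^ 2) univ := fun r _ => by fun_prop
        simpa only [Polynomial.coe_aeval_eq_eval] using hsq.aeval_polynomial P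
      have := (analyticOnNhd_marginalEntropy hμ).eq_of_frequently_eq hPan (z₀ := x)
        ((accPt_iff_frequently_nhdsNE.1 hx).mono fun r hr => hr.2)
      exact not_forall_marginalEntropy_eq_eval ha hμ hm P fun r => congrFun this r
    refine ⟨hZfin.toFinset, ?_⟩
    rw [← mem_ae_iff]
    filter_upwards [hμ, hP] with r h1 h2
    simpa [hZ] using ⟨h1, h2⟩

end Growth

/-! ### Maximizers of the output entropy -/

section Maximizer

variable {a : ℝ} {μ ν : Measure ℝ}

/-- A maximizer of the output entropy under finitely many even polynomial moment constraints has
finite support. -/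
lemma exists_finset_of_forall_Hout_le [IsProbabilityMeasure μ] (ha : 0 ≤ a)
    (hμ : ∀ᵐ r ∂μ, r ∈ Icc 0 a) {ι : Type*} [Fintype ι] (p : ι → Polynomial ℝ)
    (hmax : ∀ ν : Measure ℝ, IsProbabilityMeasure ν → (∀ᵐ r ∂ν, r ∈ Icc 0 a) →
      (∀ i, ∫ r, (p i).eval (r ^ 2) ∂ν = ∫ r, (p i).eval (r ^ 2) ∂μ) → Hout ν ≤ Hout μ) :
    ∃ s : Finset ℝ, μ ((s : Set ℝ))ᶜ = 0 := by
  let q : Option ι → Polynomial ℝ := fun i => i.elim 1 p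
  have hq : ∀ i, Continuous fun r : ℝ => (q i).eval (r ^ 2) := fun i => by fun_prop
  have hw : Continuous (marginalEntropy μ) := continuous_iff_continuousAt.2 fun x =>
    (analyticOnNhd_marginalEntropy hμ x (mem_univ x)).continuousAt
  choose B hB using fun i => isCompact_Icc.exists_bound_of_continuousOn (hq i).continuousOn
    (s := Icc 0 a)
  obtain ⟨B', hB'⟩ := isCompact_Icc.exists_bound_of_continuousOn hw.continuousOn (s := Icc 0 a)
  obtain ⟨B'', hB''⟩ := Finite.exists_le B
  obtain ⟨c, hc⟩ := exists_ae_eq_sum_of_orthogonal (μ := μ) (M := max B' B'')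
    (fun i => (hq i).measurable) hw.measurable
    (fun i => hμ.mono fun r hr => (hB i r hr).trans ((hB'' i).trans (le_max_right _ _)))
    (hμ.mono fun r hr => (hB' r hr).trans (le_max_left _ _))
    fun φ hφ ⟨C, hC⟩ h => by
      refine integral_mul_marginalEntropy_eq_zero hμ
        (f := fun (i : ι) r => (p i).eval (r ^ 2)) (fun i => hq (some i)) hmax hφ hC ?_
        fun i => h (some i)
      simpa [q] using h none
  refine exists_finset_of_marginalEntropy_eq_eval ha hμ (∑ i, Polynomial.C (c i) * q i) ?_
  filter_upwards [hc] with r hr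
  simp [hr, Polynomial.eval_finsetSum]

lemma negMulLog_midpoint_lt {x y : ℝ} (hx : 0 ≤ x) (hy : 0 ≤ y) (h : x ≠ y) :
    (negMulLog x + negMulLog y) / 2 < negMulLog ((x + y) / 2) := by
  have := Real.strictConcaveOn_negMulLog.2 hx hy h (by norm_num : (0 : ℝ) < 1 / 2)
    (by norm_num : (0 : ℝ) < 1 / 2) (by norm_num)
  simp only [smul_eq_mul] at this
  rw [show (x + y) / 2 = 1 / 2 * x + 1 / 2 * y by ring]
  linarith

lemma isProbabilityMeasure_midpoint [IsProbabilityMeasure μ] [IsProbabilityMeasure ν] :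
    IsProbabilityMeasure ((2⁻¹ : ℝ≥0∞) • (μ + ν)) := by
  constructor
  simp only [Measure.smul_apply, Measure.add_apply, measure_univ, smul_eq_mul, one_add_one_eq_two]
  exact ENNReal.inv_mul_cancel (by simp) (by simp)

lemma ae_midpoint {p : ℝ → Prop} (hμ : ∀ᵐ r ∂μ, p r) (hν : ∀ᵐ r ∂ν, p r) :
    ∀ᵐ r ∂((2⁻¹ : ℝ≥0∞) • (μ + ν)), p r :=
  Measure.ae_smul_measure (ae_add_measure_iff.2 ⟨hμ, hν⟩) _

lemma integral_midpoint {f : ℝ → ℝ} (hμ : Integrable f μ) (hν : Integrable f ν) :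
    ∫ r, f r ∂((2⁻¹ : ℝ≥0∞) • (μ + ν)) = (∫ r, f r ∂μ + ∫ r, f r ∂ν) / 2 := by
  rw [integral_smul_measure, integral_add_measure hμ hν]
  simp [div_eq_inv_mul]

lemma integrable_relDensity_mul_infoDensity [IsProbabilityMeasure μ]
    (hμ : ∀ᵐ r ∂μ, r ∈ Icc 0 a) :
    Integrable (fun R => relDensity μ R * infoDensity μ R) rayleigh :=
  integrable_relDensity_mul hμ (continuous_infoDensity hμ).aestronglyMeasurable
    (C := 1 + a ^ 2 / 2) (c := 1) fun R hR => by
      simpa using abs_infoDensity_le_exp hμ hR.le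

/-- Strict concavity of the output entropy as a functional of the output density. -/
lemma relDensity_eq_of_Hout_midpoint_le [IsProbabilityMeasure μ] [IsProbabilityMeasure ν]
    (hμ : ∀ᵐ r ∂μ, r ∈ Icc 0 a) (hν : ∀ᵐ r ∂ν, r ∈ Icc 0 a)
    (h : Hout ((2⁻¹ : ℝ≥0∞) • (μ + ν)) ≤ (Hout μ + Hout ν) / 2) {R : ℝ} (hR : 0 < R) :
    relDensity μ R = relDensity ν R := by
  have := isProbabilityMeasure_midpoint (μ := μ) (ν := ν)
  set ρ := (2⁻¹ : ℝ≥0∞) • (μ + ν) with hρdef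
  have hρ : ∀ᵐ r ∂ρ, r ∈ Icc 0 a := ae_midpoint hμ hν
  have hd : ∀ R, relDensity ρ R = (relDensity μ R + relDensity ν R) / 2 := fun R =>
    integral_midpoint (integrable_redKer hμ R) (integrable_redKer hν R)
  have hgap : ∀ R, relDensity ρ R * infoDensity ρ R -
      (relDensity μ R * infoDensity μ R + relDensity ν R * infoDensity ν R) / 2 =
      negMulLog ((relDensity μ R + relDensity ν R) / 2) -
        (negMulLog (relDensity μ R) + negMulLog (relDensity ν R)) / 2 := fun R => by
    simp only [infoDensity, negMulLog, hd]
    ring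
  have hlt : ∀ R, relDensity μ R ≠ relDensity ν R → 0 < relDensity ρ R * infoDensity ρ R -
      (relDensity μ R * infoDensity μ R + relDensity ν R * infoDensity ν R) / 2 := fun R hne => by
    rw [hgap, sub_pos]
    exact negMulLog_midpoint_lt (relDensity_pos hμ R).le (relDensity_pos hν R).le hne
  have hle : ∀ R, 0 ≤ relDensity ρ R * infoDensity ρ R -
      (relDensity μ R * infoDensity μ R + relDensity ν R * infoDensity ν R) / 2 := fun R => by
    by_cases hne : relDensity μ R = relDensity ν R
    · rw [hgap, hne, add_self_div_two, add_self_div_two, sub_self]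
    · exact (hlt R hne).le
  have iμ := integrable_relDensity_mul_infoDensity hμ
  have iν := integrable_relDensity_mul_infoDensity hν
  have iρ := integrable_relDensity_mul_infoDensity hρ
  have iμν : Integrable (fun R => (relDensity μ R * infoDensity μ R +
      relDensity ν R * infoDensity ν R) / 2) rayleigh := (iμ.add iν).div_const 2
  have hint : ∫ R, (relDensity ρ R * infoDensity ρ R - (relDensity μ R * infoDensity μ R +
      relDensity ν R * infoDensity ν R) / 2) ∂rayleigh = 0 := by
    refine le_antisymm ?_ (integral_nonneg hle)
    rw [integral_sub iρ iμν, integral_div, integral_add iμ iν, ← Hout_eq hμ, ← Hout_eq hν,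
      ← Hout_eq hρ]
    linarith
  have hae := (integral_eq_zero_iff_of_nonneg hle (iρ.sub iμν)).1 hint
  have heq : relDensity μ =ᵐ[volume.restrict (Ioi 0)] relDensity ν :=
    (ae_of_ae_rayleigh hae).mono fun R hR => by
      by_contra hne
      exact (hlt R hne).ne' hR
  exact Measure.eqOn_open_of_ae_eq heq isOpen_Ioi (continuous_relDensity hμ).continuousOn
    (continuous_relDensity hν).continuousOn hR

/-- The output density determines a finitely supported input. -/
lemma eq_of_relDensity_eq [IsFiniteMeasure μ] [IsFiniteMeasure ν]
    (hμ : ∀ᵐ r ∂μ, r ∈ Icc 0 a) (hν : ∀ᵐ r ∂ν, r ∈ Icc 0 a) {s t : Finset ℝ}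
    (hs : μ (s : Set ℝ)ᶜ = 0) (ht : ν (t : Set ℝ)ᶜ = 0)
    (h : ∀ R > 0, relDensity μ R = relDensity ν R) : μ = ν := by
  classical
  set S := (s ∪ t).filter (0 ≤ ·) with hS
  have hμS : ∀ᵐ r ∂μ, r ∈ S := by
    filter_upwards [hμ, mem_ae_iff.2 hs] with r h1 h2
    exact Finset.mem_filter.2 ⟨Finset.mem_union_left _ h2, h1.1⟩
  have hνS : ∀ᵐ r ∂ν, r ∈ S := by
    filter_upwards [hν, mem_ae_iff.2 ht] with r h1 h2
    exact Finset.mem_filter.2 ⟨Finset.mem_union_right _ h2, h1.1⟩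
  have hsum : ∀ (m : Measure ℝ) [IsFiniteMeasure m], (∀ᵐ r ∂m, r ∈ S) → ∀ R,
      relDensity m R = ∑ r ∈ S, m.real {r} * redKer R r := fun m _ hm R => by
    have := setIntegral_finset S (μ := m) (f := redKer R)
      ((continuous_redKer_right R).continuousOn.integrableOn_compact S.finite_toSet.isCompact)
    rw [Measure.restrict_eq_self_of_ae_mem hm] at this
    simpa only [smul_eq_mul, relDensity] using this
  have h0 := eq_zero_of_sum_I0_eq_zero S
    (fun r => (μ.real {r} - ν.real {r}) * Real.exp (-r ^ 2 / 2))
    (fun r hr => (Finset.mem_filter.1 hr).2) fun R hR => by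
      have := h R hR
      rw [hsum μ hμS, hsum ν hνS, ← sub_eq_zero, ← Finset.sum_sub_distrib] at this
      rw [← this]
      refine Finset.sum_congr rfl fun r _ => ?_
      rw [redKer]; ring
  rw [Measure.ae_mem_finset_iff.1 hμS, Measure.ae_mem_finset_iff.1 hνS]
  refine Finset.sum_congr rfl fun r hr => ?_
  have := (mul_eq_zero.1 (h0 r hr)).resolve_right (Real.exp_pos _).ne'
  rw [(measureReal_eq_measureReal_iff).1 (sub_eq_zero.1 this)]

lemma continuous_integral_map_val {f : ℝ → ℝ} (hf : Continuous f) :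
    Continuous fun P : ProbabilityMeasure (Icc 0 a) =>
      ∫ r, f r ∂(P : Measure (Icc 0 a)).map Subtype.val := by
  have := ProbabilityMeasure.continuous_integral_continuousMap
    (⟨fun x : Icc 0 a => f x, by fun_prop⟩ : C(Icc 0 a, ℝ))
  refine this.congr fun P => ?_
  rw [integral_map measurable_subtype_coe.aemeasurable hf.aestronglyMeasurable]
  rfl

lemma isProbabilityMeasure_map_val (P : ProbabilityMeasure (Icc 0 a)) :
    IsProbabilityMeasure ((P : Measure (Icc 0 a)).map Subtype.val) :=
  Measure.isProbabilityMeasure_map measurable_subtype_coe.aemeasurable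

lemma ae_mem_map_val (P : ProbabilityMeasure (Icc 0 a)) :
    ∀ᵐ r ∂(P : Measure (Icc 0 a)).map Subtype.val, r ∈ Icc 0 a := by
  exact (ae_map_iff (p := (· ∈ Icc 0 a)) measurable_subtype_coe.aemeasurable measurableSet_Icc).2
    (Eventually.of_forall fun x => x.2)

lemma exists_probabilityMeasure_map_val_eq [IsProbabilityMeasure μ]
    (hμ : ∀ᵐ r ∂μ, r ∈ Icc 0 a) :
    ∃ P : ProbabilityMeasure (Icc 0 a), (P : Measure (Icc 0 a)).map Subtype.val = μ := by
  have hmap : (μ.comap (Subtype.val : Icc 0 a → ℝ)).map Subtype.val = μ := by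
    rw [map_comap_subtype_coe measurableSet_Icc, Measure.restrict_eq_self_of_ae_mem hμ]
  refine ⟨⟨μ.comap Subtype.val, ⟨?_⟩⟩, hmap⟩
  rw [← measure_univ (μ := μ), ← congrArg (fun m : Measure ℝ => m univ) hmap]
  simp [Measure.map_apply measurable_subtype_coe]

lemma continuous_Hout_map_val :
    Continuous fun P : ProbabilityMeasure (Icc 0 a) =>
      Hout ((P : Measure (Icc 0 a)).map Subtype.val) := by
  have := isProbabilityMeasure_map_val (a := a)
  have hae := ae_mem_map_val (a := a)
  simp only [fun P => Hout_eq (hae P)]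
  refine continuous_of_dominated
    (bound := fun R => (1 + a ^ 2 / 2) * Real.exp ((a + 1) * R)) (fun P => ?_) (fun P => ?_) ?_ ?_
  · exact (integrable_relDensity_mul_infoDensity (hae P)).aestronglyMeasurable
  · refine ae_rayleigh_of_forall fun R hR => ?_
    rw [norm_mul, Real.norm_eq_abs, Real.norm_eq_abs, abs_of_pos (relDensity_pos (hae P) R),
      add_mul a, one_mul, Real.exp_add, mul_left_comm]
    exact mul_le_mul (relDensity_le_exp (hae P) hR.le) (abs_infoDensity_le_exp (hae P) hR.le)
      (abs_nonneg _) (Real.exp_pos _).le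
  · exact (integrable_exp_rayleigh _).const_mul _
  · refine Eventually.of_forall fun R => ?_
    have hc := continuous_integral_map_val (a := a) (continuous_redKer_right R)
    exact hc.mul (continuous_const.sub (hc.log fun P => (relDensity_pos (hae P) R).ne'))

/-- The output entropy attains its maximum under closed moment constraints. -/
lemma exists_forall_Hout_le {ι : Type*} {f : ι → ℝ → ℝ} (hf : ∀ i, Continuous (f i)) (b : ι → ℝ)
    (hne : ∃ μ : Measure ℝ, IsProbabilityMeasure μ ∧ (∀ᵐ r ∂μ, r ∈ Icc 0 a) ∧
      ∀ i, ∫ r, f i r ∂μ ≤ b i) :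
    ∃ μ : Measure ℝ, (IsProbabilityMeasure μ ∧ (∀ᵐ r ∂μ, r ∈ Icc 0 a) ∧
      ∀ i, ∫ r, f i r ∂μ ≤ b i) ∧
      ∀ ν : Measure ℝ, IsProbabilityMeasure ν → (∀ᵐ r ∂ν, r ∈ Icc 0 a) →
        (∀ i, ∫ r, f i r ∂ν ≤ b i) → Hout ν ≤ Hout μ := by
  let K : Set (ProbabilityMeasure (Icc 0 a)) :=
    {P | ∀ i, ∫ r, f i r ∂(P : Measure (Icc 0 a)).map Subtype.val ≤ b i}
  have hK : IsClosed K := by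
    simp only [K, ofPred_forall]
    exact isClosed_iInter fun i =>
      isClosed_le (continuous_integral_map_val (hf i)) continuous_const
  have hKne : K.Nonempty := by
    obtain ⟨μ, hp, hμ, h⟩ := hne
    obtain ⟨P, rfl⟩ := exists_probabilityMeasure_map_val_eq hμ
    exact ⟨P, h⟩
  obtain ⟨P, hP, hmax⟩ := hK.isCompact.exists_isMaxOn hKne continuous_Hout_map_val.continuousOn
  refine ⟨_, ⟨isProbabilityMeasure_map_val P, ae_mem_map_val P, hP⟩, fun ν hp hν h => ?_⟩
  obtain ⟨Q, rfl⟩ := exists_probabilityMeasure_map_val_eq hν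
  exact hmax h

end Maximizer

theorem stmt_2 (rp Pa Pd : ℝ) (hrp : 0 < rp) (hPa : 0 < Pa)
    (n : ℕ) (hn : 2 ≤ n) (α : ℕ → ℝ) (hαn : 0 < α n)
    (g : ℝ → ℝ) (hgdef : ∀ r : ℝ, g r = ∑ i ∈ Finset.range (n + 1), α i * r ^ (2 * i))
    (hgpos : ∀ r : ℝ, 0 ≤ r → 0 < g r)
    (hne : ∃ μ : Measure ℝ, IsProbabilityMeasure μ ∧ μ (Icc 0 rp)ᶜ = 0 ∧
      (∫ r, r ^ 2 ∂μ) ≤ Pa ∧ Pd ≤ (∫ r, g r ∂μ)) :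
    ∃ μo : Measure ℝ,
      (IsProbabilityMeasure μo ∧ μo (Icc 0 rp)ᶜ = 0 ∧
        (∫ r, r ^ 2 ∂μo) ≤ Pa ∧ Pd ≤ (∫ r, g r ∂μo)) ∧
      (∀ ν : Measure ℝ, IsProbabilityMeasure ν → ν (Icc 0 rp)ᶜ = 0 →
        (∫ r, r ^ 2 ∂ν) ≤ Pa → Pd ≤ (∫ r, g r ∂ν) → Hout ν ≤ Hout μo) ∧
      (∀ ν : Measure ℝ, IsProbabilityMeasure ν → ν (Icc 0 rp)ᶜ = 0 →
        (∫ r, r ^ 2 ∂ν) ≤ Pa → Pd ≤ (∫ r, g r ∂ν) →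
        (∀ ρ : Measure ℝ, IsProbabilityMeasure ρ → ρ (Icc 0 rp)ᶜ = 0 →
          (∫ r, r ^ 2 ∂ρ) ≤ Pa → Pd ≤ (∫ r, g r ∂ρ) → Hout ρ ≤ Hout ν) →
        ν = μo) ∧
      (∃ s : Finset ℝ, μo ((s : Set ℝ))ᶜ = 0) := by
  let Q : Polynomial ℝ := ∑ i ∈ Finset.range (n + 1), Polynomial.C (α i) * Polynomial.X ^ i
  have hgQ : ∀ r, g r = Q.eval (r ^ 2) := fun r => by
    simp [hgdef, Q, Polynomial.eval_finsetSum, pow_mul]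
  have hg : Continuous g := by
    rw [funext hgQ]
    fun_prop
  have hfin : ∀ μ : Measure ℝ, IsProbabilityMeasure μ → μ (Icc 0 rp)ᶜ = 0 →
      (∫ r, r ^ 2 ∂μ) ≤ Pa → Pd ≤ (∫ r, g r ∂μ) →
      (∀ ρ : Measure ℝ, IsProbabilityMeasure ρ → ρ (Icc 0 rp)ᶜ = 0 →
        (∫ r, r ^ 2 ∂ρ) ≤ Pa → Pd ≤ (∫ r, g r ∂ρ) → Hout ρ ≤ Hout μ) →
      ∃ s : Finset ℝ, μ ((s : Set ℝ))ᶜ = 0 := fun μ hp hμ h1 h2 hmax => by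
    refine exists_finset_of_forall_Hout_le hrp.le (mem_ae_iff.2 hμ) ![Polynomial.X, Q]
      fun ν hνp hν hi => hmax ν hνp (mem_ae_iff.1 hν) ?_ ?_
    · simpa using (hi 0).trans_le (by simpa using h1)
    · have := hi 1
      simp only [Matrix.cons_val_one, Matrix.cons_val_zero, ← hgQ] at this
      rwa [this]
  obtain ⟨μ, ⟨hp, hμ, hi⟩, hmax⟩ := exists_forall_Hout_le (a := rp)
    (f := ![fun r => r ^ 2, fun r => -g r]) (b := ![Pa, -Pd])
    (Fin.forall_fin_two.2 ⟨continuous_pow 2, hg.neg⟩) (by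
      obtain ⟨μ, hp, hμ, h1, h2⟩ := hne
      refine ⟨μ, hp, mem_ae_iff.2 hμ, Fin.forall_fin_two.2 ⟨h1, ?_⟩⟩
      simpa [integral_neg] using h2)
  have h1 : ∫ r, r ^ 2 ∂μ ≤ Pa := hi 0
  have h2 : Pd ≤ ∫ r, g r ∂μ := by simpa [integral_neg] using hi 1
  have hmax' : ∀ ν : Measure ℝ, IsProbabilityMeasure ν → ν (Icc 0 rp)ᶜ = 0 →
      (∫ r, r ^ 2 ∂ν) ≤ Pa → Pd ≤ (∫ r, g r ∂ν) → Hout ν ≤ Hout μ := fun ν hνp hν k1 k2 => by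
    refine hmax ν hνp (mem_ae_iff.2 hν) (Fin.forall_fin_two.2 ⟨k1, ?_⟩)
    simpa [integral_neg] using k2
  have hμ0 := mem_ae_iff.1 hμ
  refine ⟨μ, ⟨hp, hμ0, h1, h2⟩, hmax', fun ν hνp hν0 k1 k2 hνmax => ?_,
    hfin μ hp hμ0 h1 h2 hmax'⟩
  have hν : ∀ᵐ r ∂ν, r ∈ Icc 0 rp := mem_ae_iff.2 hν0
  obtain ⟨s, hs⟩ := hfin μ hp hμ0 h1 h2 hmax'
  obtain ⟨t, ht⟩ := hfin ν hνp hν0 k1 k2 hνmax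
  refine eq_of_relDensity_eq hν hμ ht hs fun R hR => ?_
  refine relDensity_eq_of_Hout_midpoint_le hν hμ ?_ hR
  have hmid : ∀ {f : ℝ → ℝ}, Continuous f → ∫ r, f r ∂((2⁻¹ : ℝ≥0∞) • (ν + μ)) =
      (∫ r, f r ∂ν + ∫ r, f r ∂μ) / 2 := fun hf =>
    integral_midpoint (integrable_of_continuous_of_ae_mem_Icc hν hf)
      (integrable_of_continuous_of_ae_mem_Icc hμ hf)
  have := hmax' _ isProbabilityMeasure_midpoint (mem_ae_iff.1 (ae_midpoint hν hμ))
    (by rw [hmid (continuous_pow 2)]; linarith) (by rw [hmid hg]; linarith)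
  linarith [hνmax μ hp hμ0 h1 h2]
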